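/- arXiv:2506.11118 — 5 statements merged into one kernel-verified Lean document; each statement's English description precedes it below -/
import Mathlib

section
/- Let X be a topological space, M ⊆ X, and let 𝓖 be a family of subsets of X such that every member of 𝓖 has nonempty interior and every nonempty open subset of X contains a member of 𝓖. Then player 2 has a winning strategy in the Banach–Mazur game BM⟨M, X∖M⟩ if and only if M is meager in X. -/
/-- `f` is a winning strategy for player 2 in the Banach–Mazur game `BM⟨M, X∖M⟩` played with
the family `𝓖`.  A play is a decreasing sequence `G 0 ⊇ G 1 ⊇ ⋯` of members of `𝓖`
(`G 0, G 2, …` are player 1's moves `G₁, G₃, …` and `G 1, G 3, …` are player 2's moves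
`G₂, G₄, …`).  A strategy for player 2 assigns to every finite decreasing sequence
`(G₁, …, G_{2k−1})` of members of `𝓖` a member of `𝓖` contained in `G_{2k−1}`;
it is winning if every play in which player 2 follows it satisfies `M ∩ ⋂ₙ Gₙ = ∅`. -/
def IsWinningStrategyP2 {X : Type*} [TopologicalSpace X] (𝓖 : Set (Set X)) (M : Set X)
    (f : (k : ℕ) → (Fin (2 * k + 1) → Set X) → Set X) : Prop :=
  (∀ (k : ℕ) (h : Fin (2 * k + 1) → Set X),
      (∀ i, h i ∈ 𝓖) →
      (∀ i : Fin (2 * k), h i.succ ⊆ h i.castSucc) →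
      f k h ∈ 𝓖 ∧ f k h ⊆ h (Fin.last (2 * k))) ∧
  (∀ G : ℕ → Set X,
      (∀ n, G n ∈ 𝓖) → (∀ n, G (n + 1) ⊆ G n) →
      (∀ k, G (2 * k + 1) = f k (fun i => G i.val)) →
      M ∩ ⋂ n, G n = ∅)

open Set

namespace BanachMazur

/-- If every nonempty open set contains a nonempty `W i` with `i ∈ S`, then some subfamily of
`(W i)_{i ∈ S}` is pairwise disjoint and has dense union. -/
lemma exists_pairwiseDisjoint_dense {X ι : Type*} [TopologicalSpace X] (S : Set ι)
    (W : ι → Set X)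
    (hS : ∀ V : Set X, IsOpen V → V.Nonempty → ∃ i ∈ S, (W i).Nonempty ∧ W i ⊆ V) :
    ∃ A ⊆ S, A.PairwiseDisjoint W ∧ Dense (⋃ i ∈ A, W i) := by
  obtain ⟨A, hA⟩ := zorn_subset {A : Set ι | A ⊆ S ∧ A.PairwiseDisjoint W} (by
    intro c hc hchain
    refine ⟨⋃₀ c, ⟨sUnion_subset fun B hB => (hc hB).1, ?_⟩, fun B hB => subset_sUnion_of_mem hB⟩
    exact (pairwiseDisjoint_sUnion hchain.directedOn).2 fun B hB => (hc hB).2)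
  refine ⟨A, hA.prop.1, hA.prop.2, dense_iff_inter_open.2 fun V hV hVne => ?_⟩
  obtain ⟨i, hiS, ⟨x, hx⟩, hiV⟩ := hS V hV hVne
  by_contra hempty
  have hdisj : ∀ j ∈ A, Disjoint (W i) (W j) := fun j hj =>
    disjoint_left.2 fun y hyi hyj => hempty ⟨y, hiV hyi, mem_biUnion hj hyj⟩
  have hiA : i ∈ A := hA.le_of_ge (y := insert i A)
    ⟨insert_subset hiS hA.prop.1, hA.prop.2.insert fun j hj _ => hdisj j hj⟩
    (subset_insert i A) (mem_insert i A)
  exact disjoint_left.1 (hdisj i hiA) hx hx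

variable {X : Type*} {𝓖 : Set (Set X)} {M : Set X}
  {f : (k : ℕ) → (Fin (2 * k + 1) → Set X) → Set X}

/-- The first `2 * k` terms of `s` form a partial play in which player 2 follows `f`. -/
structure IsPosition (𝓖 : Set (Set X)) (f : (k : ℕ) → (Fin (2 * k + 1) → Set X) → Set X)
    (k : ℕ) (s : ℕ → Set X) : Prop where
  mem : ∀ n < 2 * k, s n ∈ 𝓖
  subset : ∀ n, n + 1 < 2 * k → s (n + 1) ⊆ s n
  reply : ∀ j < k, s (2 * j + 1) = f j (fun i => s i)

/-- Extend the position `s` after `k` rounds by player 1's move `G` and the reply given by `f`. -/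
def extend (f : (k : ℕ) → (Fin (2 * k + 1) → Set X) → Set X) (k : ℕ) (s : ℕ → Set X)
    (G : Set X) (n : ℕ) : Set X :=
  if n < 2 * k then s n else if n = 2 * k then G else f k fun i => if i < 2 * k then s i else G

lemma extend_of_lt {k n : ℕ} (s : ℕ → Set X) (G : Set X) (h : n < 2 * k) :
    extend f k s G n = s n := if_pos h

lemma extend_two_mul (k : ℕ) (s : ℕ → Set X) (G : Set X) : extend f k s G (2 * k) = G := by
  simp [extend]

lemma extend_two_mul_add_one (k : ℕ) (s : ℕ → Set X) (G : Set X) :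
    extend f k s G (2 * k + 1) = f k fun i => extend f k s G i := by
  have h : ∀ i : Fin (2 * k + 1),
      extend f k s G i = if (i : ℕ) < 2 * k then s i else G := by
    intro i
    have := i.isLt
    unfold extend
    split_ifs <;> first | rfl | omega
  simp only [h]
  simp [extend]

variable [TopologicalSpace X]

/-- The interior of the last set played after `k` rounds (the whole space if `k = 0`). -/
def region (s : ℕ → Set X) : ℕ → Set X
  | 0 => univ
  | k + 1 => interior (s (2 * k + 1))

lemma isOpen_region (s : ℕ → Set X) (k : ℕ) : IsOpen (region s k) := by
  cases k with
  | zero => exact isOpen_univ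
  | succ k => exact isOpen_interior

lemma IsPosition.extend_of_subset (hf : IsWinningStrategyP2 𝓖 M f) {k : ℕ} {s : ℕ → Set X}
    (hs : IsPosition 𝓖 f k s) {G : Set X} (hG : G ∈ 𝓖) (hGs : G ⊆ region s k) :
    IsPosition 𝓖 f (k + 1) (extend f k s G) ∧ extend f k s G (2 * k + 1) ⊆ G := by
  have hmem : ∀ n < 2 * k + 1, extend f k s G n ∈ 𝓖 := by
    intro n hn
    rcases Nat.lt_succ_iff_lt_or_eq.1 hn with h | rfl
    · rw [extend_of_lt s G h]
      exact hs.mem n h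
    · rwa [extend_two_mul]
  have hsub : ∀ n < 2 * k, extend f k s G (n + 1) ⊆ extend f k s G n := by
    intro n hn
    rw [extend_of_lt s G hn]
    rcases (Nat.succ_le_of_lt hn).lt_or_eq with h | h
    · rw [extend_of_lt s G h]
      exact hs.subset n h
    · rw [show n + 1 = 2 * k from h, extend_two_mul]
      obtain ⟨m, rfl⟩ : ∃ m, k = m + 1 := ⟨k - 1, by omega⟩
      obtain rfl : n = 2 * m + 1 := by omega
      exact hGs.trans interior_subset
  obtain ⟨hr, hrG⟩ := hf.1 k (fun i => extend f k s G i) (fun i => hmem i i.isLt)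
    (fun i => by simpa using hsub i i.isLt)
  rw [← extend_two_mul_add_one (f := f) k s G] at hr hrG
  simp only [Fin.val_last] at hrG
  refine ⟨⟨fun n hn => ?_, fun n hn => ?_, fun j hj => ?_⟩, by rwa [extend_two_mul] at hrG⟩
  · rcases (show n < 2 * k + 1 ∨ n = 2 * k + 1 by omega) with h | rfl
    · exact hmem n h
    · exact hr
  · rcases (show n < 2 * k ∨ n = 2 * k by omega) with h | rfl
    · exact hsub n h
    · exact hrG
  · rcases Nat.lt_succ_iff_lt_or_eq.1 hj with h | rfl
    · rw [extend_of_lt s G (by omega), hs.reply j h]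
      congr 1
      ext1 i
      rw [extend_of_lt s G (by omega)]
    · exact extend_two_mul_add_one j s G

/-- `T` is a set of positions after `k` rounds whose regions are pairwise disjoint and have dense
union. -/
structure IsLevel (𝓖 : Set (Set X)) (f : (k : ℕ) → (Fin (2 * k + 1) → Set X) → Set X)
    (k : ℕ) (T : Set (ℕ → Set X)) : Prop where
  isPosition : ∀ s ∈ T, IsPosition 𝓖 f k s
  disjoint : T.PairwiseDisjoint (region · k)
  dense : Dense (⋃ s ∈ T, region s k)

lemma isLevel_zero : IsLevel 𝓖 f 0 {fun _ => univ} where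
  isPosition _ _ := ⟨by simp, by simp, by simp⟩
  disjoint := pairwiseDisjoint_singleton _ _
  dense := by simp [region]

lemma IsLevel.exists_succ (h𝓖₁ : ∀ G ∈ 𝓖, (interior G).Nonempty)
    (h𝓖₂ : ∀ U : Set X, IsOpen U → U.Nonempty → ∃ G ∈ 𝓖, G ⊆ U)
    (hf : IsWinningStrategyP2 𝓖 M f) {k : ℕ} {T : Set (ℕ → Set X)} (hT : IsLevel 𝓖 f k T) :
    ∃ T', IsLevel 𝓖 f (k + 1) T' ∧ ∀ t ∈ T', ∃ s ∈ T,
      region t (k + 1) ⊆ region s k ∧ ∀ n < 2 * k, t n = s n := by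
  obtain ⟨T', hT', hdisj, hdense⟩ := exists_pairwiseDisjoint_dense
    {t | ∃ s ∈ T, ∃ G ∈ 𝓖, G ⊆ region s k ∧ t = extend f k s G} (region · (k + 1)) (by
      intro V hV hVne
      obtain ⟨x, hxV, hx⟩ := hT.dense.inter_open_nonempty V hV hVne
      obtain ⟨s, hs, hxs⟩ := mem_iUnion₂.1 hx
      obtain ⟨G, hG, hGV⟩ := h𝓖₂ (V ∩ region s k) (hV.inter (isOpen_region s k)) ⟨x, hxV, hxs⟩
      have hGs := hGV.trans inter_subset_right
      obtain ⟨hpos, hsub⟩ := (hT.isPosition s hs).extend_of_subset hf hG hGs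
      exact ⟨_, ⟨s, hs, G, hG, hGs, rfl⟩, h𝓖₁ _ (hpos.mem _ (by omega)),
        interior_subset.trans (hsub.trans (hGV.trans inter_subset_left))⟩)
  refine ⟨T', ⟨fun t ht => ?_, hdisj, hdense⟩, fun t ht => ?_⟩
  · obtain ⟨s, hs, G, hG, hGs, rfl⟩ := hT' ht
    exact ((hT.isPosition s hs).extend_of_subset hf hG hGs).1
  · obtain ⟨s, hs, G, hG, hGs, rfl⟩ := hT' ht
    have hsub := ((hT.isPosition s hs).extend_of_subset hf hG hGs).2
    exact ⟨s, hs, interior_subset.trans (hsub.trans hGs), fun n hn => extend_of_lt s G hn⟩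

lemma exists_levels (h𝓖₁ : ∀ G ∈ 𝓖, (interior G).Nonempty)
    (h𝓖₂ : ∀ U : Set X, IsOpen U → U.Nonempty → ∃ G ∈ 𝓖, G ⊆ U)
    (hf : IsWinningStrategyP2 𝓖 M f) :
    ∃ T : ℕ → Set (ℕ → Set X), (∀ k, IsLevel 𝓖 f k (T k)) ∧ ∀ k, ∀ t ∈ T (k + 1), ∃ s ∈ T k,
      region t (k + 1) ⊆ region s k ∧ ∀ n < 2 * k, t n = s n := by
  choose! next hlevel hnext using
    fun (k : ℕ) (T : Set (ℕ → Set X)) (hT : IsLevel 𝓖 f k T) => hT.exists_succ h𝓖₁ h𝓖₂ hf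
  let T : ℕ → Set (ℕ → Set X) := fun k => Nat.rec {fun _ => univ} next k
  have hT : ∀ k, IsLevel 𝓖 f k (T k) := fun k => by
    induction k with
    | zero => exact isLevel_zero
    | succ k ih => exact hlevel k _ ih
  exact ⟨T, hT, fun k => hnext k _ (hT k)⟩

/-- A point lying in the region of one position of each level lies outside `M`, because these
positions are the initial segments of a single play won by player 2. -/
lemma notMem_of_forall_mem_region (hf : IsWinningStrategyP2 𝓖 M f) {T : ℕ → Set (ℕ → Set X)}
    (hT : ∀ k, IsLevel 𝓖 f k (T k))
    (hnext : ∀ k, ∀ t ∈ T (k + 1), ∃ s ∈ T k,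
      region t (k + 1) ⊆ region s k ∧ ∀ n < 2 * k, t n = s n)
    {x : X} (hx : ∀ k, ∃ s ∈ T k, x ∈ region s k) : x ∉ M := by
  choose s hsT hxs using hx
  have hstep : ∀ k, ∀ n < 2 * k, s (k + 1) n = s k n := by
    intro k n hn
    obtain ⟨t, ht, hsub, heq⟩ := hnext k _ (hsT (k + 1))
    have hts : t = s k :=
      (hT k).disjoint.elim_set ht (hsT k) x (hsub (hxs (k + 1))) (hxs k)
    rw [heq n hn, hts]
  have hmono : ∀ m k, m ≤ k → ∀ n < 2 * m, s k n = s m n := by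
    intro m k hmk n hn
    induction k, hmk using Nat.le_induction with
    | base => rfl
    | succ k hmk ih => rw [hstep k n (by omega), ih]
  let G : ℕ → Set X := fun n => s (n + 1) n
  have hG : ∀ k, ∀ n < 2 * k, s k n = G n := by
    intro k n hn
    rcases le_total k (n + 1) with h | h
    · exact (hmono k (n + 1) h n hn).symm
    · exact hmono (n + 1) k h n (by omega)
  have hpos : ∀ k, IsPosition 𝓖 f k (s k) := fun k => (hT k).isPosition _ (hsT k)
  have hsub : ∀ n, G (n + 1) ⊆ G n := by
    intro n
    rw [← hG (n + 2) n (by omega), ← hG (n + 2) (n + 1) (by omega)]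
    exact (hpos (n + 2)).subset n (by omega)
  have hplay : M ∩ ⋂ n, G n = ∅ := by
    refine hf.2 G (fun n => (hpos (n + 1)).mem n (by omega)) hsub fun k => ?_
    rw [← hG (k + 1) (2 * k + 1) (by omega), (hpos (k + 1)).reply k (by omega)]
    congr 1
    ext1 i
    rw [hG (k + 1) i (by omega)]
  intro hxM
  refine hplay.subset ⟨hxM, mem_iInter.2 fun n => ?_⟩
  have hxn : x ∈ s (n + 1) (2 * n + 1) := interior_subset (hxs (n + 1))
  rw [hG (n + 1) (2 * n + 1) (by omega)] at hxn
  exact antitone_nat_of_succ_le hsub (by omega) hxn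

lemma isMeagre_of_isWinningStrategyP2 (h𝓖₁ : ∀ G ∈ 𝓖, (interior G).Nonempty)
    (h𝓖₂ : ∀ U : Set X, IsOpen U → U.Nonempty → ∃ G ∈ 𝓖, G ⊆ U)
    (hf : IsWinningStrategyP2 𝓖 M f) : IsMeagre M := by
  obtain ⟨T, hT, hnext⟩ := exists_levels h𝓖₁ h𝓖₂ hf
  have hres : ⋂ k, ⋃ s ∈ T k, region s k ∈ residual X := countable_iInter_mem.2 fun k =>
    residual_of_dense_open (isOpen_biUnion fun s _ => isOpen_region s k) (hT k).dense
  refine Filter.mem_of_superset hres fun x hx => ?_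
  exact notMem_of_forall_mem_region hf hT hnext fun k => by simpa using mem_iInter.1 hx k

lemma _root_.IsMeagre.exists_isOpen_dense_iInter (hM : IsMeagre M) :
    ∃ U : ℕ → Set X, (∀ k, IsOpen (U k)) ∧ (∀ k, Dense (U k)) ∧ M ∩ ⋂ k, U k = ∅ := by
  obtain ⟨S, hopen, hdense, hcount, hsub⟩ := mem_residual_iff.1 hM
  obtain ⟨U, hU⟩ := (hcount.insert univ).exists_eq_range (insert_nonempty _ _)
  have hmem : ∀ k, U k = univ ∨ U k ∈ S := fun k => by
    simpa using hU.symm.subset (mem_range_self k)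
  refine ⟨U, fun k => ?_, fun k => ?_, ?_⟩
  · rcases hmem k with h | h
    · exact h ▸ isOpen_univ
    · exact hopen _ h
  · rcases hmem k with h | h
    · exact h ▸ dense_univ
    · exact hdense _ h
  · refine eq_empty_of_forall_notMem fun x hx => hsub (fun V hV => ?_) hx.1
    obtain ⟨k, rfl⟩ := hU.subset (mem_insert_of_mem _ hV)
    exact mem_iInter.1 hx.2 k

lemma exists_isWinningStrategyP2_of_isMeagre (h𝓖₁ : ∀ G ∈ 𝓖, (interior G).Nonempty)
    (h𝓖₂ : ∀ U : Set X, IsOpen U → U.Nonempty → ∃ G ∈ 𝓖, G ⊆ U) (hM : IsMeagre M) :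
    ∃ f, IsWinningStrategyP2 𝓖 M f := by
  obtain ⟨U, hopen, hdense, hU⟩ := hM.exists_isOpen_dense_iInter
  have hmove : ∀ k, ∀ G ∈ 𝓖, ∃ G' ∈ 𝓖, G' ⊆ interior G ∩ U k := fun k G hG =>
    h𝓖₂ _ (isOpen_interior.inter (hopen k))
      ((hdense k).inter_open_nonempty _ isOpen_interior (h𝓖₁ G hG))
  choose! g hg hgsub using hmove
  refine ⟨fun k h => g k (h (Fin.last _)), fun k h hmem _ => ⟨hg k _ (hmem _), ?_⟩,
    fun G hmem _ hreply => ?_⟩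
  · exact ((hgsub k _ (hmem _)).trans inter_subset_left).trans interior_subset
  · refine subset_empty_iff.1 (hU ▸ inter_subset_inter_right M (subset_iInter fun k => ?_))
    refine (iInter_subset G (2 * k + 1)).trans ?_
    rw [hreply k]
    exact (hgsub k _ (hmem _)).trans inter_subset_right

end BanachMazur

/-- Banach–Mazur game characterization of meager sets: if every member of `𝓖` has nonempty
interior and every nonempty open set contains a member of `𝓖`, then player 2 has a winning
strategy in `BM⟨M, X∖M⟩` if and only if `M` is meager in `X`. -/
theorem banach_mazur_meagre_iff_winning_strategy_P2
    {X : Type*} [TopologicalSpace X] (M : Set X) (𝓖 : Set (Set X))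
    (h𝓖₁ : ∀ G ∈ 𝓖, (interior G).Nonempty)
    (h𝓖₂ : ∀ U : Set X, IsOpen U → U.Nonempty → ∃ G ∈ 𝓖, G ⊆ U) :
    (∃ f, IsWinningStrategyP2 𝓖 M f) ↔ IsMeagre M := by
  exact ⟨fun ⟨_, hf⟩ => BanachMazur.isMeagre_of_isWinningStrategyP2 h𝓖₁ h𝓖₂ hf,
    BanachMazur.exists_isWinningStrategyP2_of_isMeagre h𝓖₁ h𝓖₂⟩
end

section
/- Let X be a nonempty complete metric space, M ⊆ X, and let 𝓖 be a family of subsets of X such that every member of 𝓖 has nonempty interior and every nonempty open subset of X contains a member of 𝓖. Then player 1 has a winning strategy in the Banach–Mazur game BM⟨X∖M, M⟩ if and only if M is of first category at some point of X, i.e., there exists a nonempty open set U ⊆ X such that U ∩ M is meager in X. -/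
/-- `f` is a winning strategy for player 1, with target set `target`, in the Banach–Mazur game
played with the family `𝓖`.  A play is a decreasing sequence `G 0 ⊇ G 1 ⊇ ⋯` of members of `𝓖`
(`G 0, G 2, …` are player 1's moves `G₁, G₃, …` and `G 1, G 3, …` are player 2's moves
`G₂, G₄, …`).  A strategy for player 1 assigns to the empty sequence a member `G₁ ∈ 𝓖` and to
every finite decreasing sequence `(G₁, …, G_{2k})` of members of `𝓖` a member of `𝓖` contained
in `G_{2k}`; it is winning if every play consistent with it satisfies
`target ∩ ⋂ₙ Gₙ ≠ ∅`. -/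
def IsWinningStrategyP1 {X : Type*} [TopologicalSpace X] (𝓖 : Set (Set X)) (target : Set X)
    (f : (k : ℕ) → (Fin (2 * k) → Set X) → Set X) : Prop :=
  (∀ (k : ℕ) (h : Fin (2 * k) → Set X),
      (∀ i, h i ∈ 𝓖) →
      (∀ i j : Fin (2 * k), (i : ℕ) + 1 = (j : ℕ) → h j ⊆ h i) →
      f k h ∈ 𝓖 ∧ ∀ i : Fin (2 * k), (i : ℕ) + 1 = 2 * k → f k h ⊆ h i) ∧
  (∀ G : ℕ → Set X,
      (∀ n, G n ∈ 𝓖) → (∀ n, G (n + 1) ⊆ G n) →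
      (∀ k, G (2 * k) = f k (fun i => G i.val)) →
      (target ∩ ⋂ n, G n).Nonempty)

open Set Filter Topology

/-- Every open set `U` in which arbitrarily small members of an indexed family of nonempty open
sets can be found contains a pairwise disjoint subfamily with dense union in `U`. -/
lemma exists_pairwiseDisjoint_subset_closure_biUnion {X S : Type*} [TopologicalSpace X]
    (Q : S → Prop) (V : S → Set X) {U : Set X} (hU : IsOpen U)
    (h : ∀ O ⊆ U, IsOpen O → O.Nonempty → ∃ s, Q s ∧ (V s).Nonempty ∧ V s ⊆ O) :
    ∃ T : Set S, (∀ s ∈ T, Q s) ∧ T.PairwiseDisjoint V ∧ U ⊆ closure (⋃ s ∈ T, V s) := by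
  obtain ⟨T, hT⟩ := zorn_subset {T : Set S | (∀ s ∈ T, Q s) ∧ T.PairwiseDisjoint V} (by
    intro c hc hchain
    refine ⟨⋃₀ c, ⟨?_, ?_⟩, fun t ht => subset_sUnion_of_mem ht⟩
    · rintro s ⟨t, ht, hst⟩
      exact (hc ht).1 s hst
    · exact (pairwiseDisjoint_sUnion hchain.directedOn).2 fun t ht => (hc ht).2)
  refine ⟨T, hT.prop.1, hT.prop.2, ?_⟩
  by_contra hnot
  obtain ⟨x, hxU, hx⟩ := not_subset.1 hnot
  obtain ⟨s, hQ, ⟨y, hy⟩, hs⟩ := h (U \ closure (⋃ s ∈ T, V s)) sdiff_subset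
    (hU.sdiff isClosed_closure) ⟨x, hxU, hx⟩
  have hdisj : ∀ t ∈ T, Disjoint (V s) (V t) := fun t ht =>
    disjoint_left.2 fun z hz hzt => (hs hz).2 (subset_closure (mem_biUnion ht hzt))
  have hsT : s ∈ T := by
    refine hT.le_of_ge (y := insert s T) ⟨?_, ?_⟩ (subset_insert s T) (mem_insert s T)
    · rintro t (rfl | ht)
      exacts [hQ, hT.prop.1 t ht]
    · exact hT.prop.2.insert fun t ht _ => hdisj t ht
  exact disjoint_left.1 (hdisj s hsT) hy hy

/-- Consider a tree of positions `s`, each at level `n` carrying an open set `V n s` that shrinks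
along successors, such that every position has a successor inside each given nonempty open subset.
Then residually many points of the root set lie on an infinite branch. -/
lemma eventually_residual_exists_branch {X S : Type*} [TopologicalSpace X]
    (P : ℕ → S → Prop) (R : ℕ → S → S → Prop) (V : ℕ → S → Set X) (s₀ : S)
    (hP : P 0 s₀) (hV : ∀ n s, IsOpen (V n s))
    (hmono : ∀ n s t, R n s t → V (n + 1) t ⊆ V n s)
    (hex : ∀ n s, P n s → ∀ O ⊆ V n s, IsOpen O → O.Nonempty →
      ∃ t, (P (n + 1) t ∧ R n s t) ∧ (V (n + 1) t).Nonempty ∧ V (n + 1) t ⊆ O) :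
    ∀ᶠ x in residual X, x ∈ V 0 s₀ →
      ∃ s : ℕ → S, (∀ n, P n (s n) ∧ x ∈ V n (s n)) ∧ ∀ n, R n (s n) (s (n + 1)) := by
  have hfam : ∀ n s, P n s → ∃ A : Set S, (∀ t ∈ A, P (n + 1) t ∧ R n s t) ∧
      A.PairwiseDisjoint (V (n + 1)) ∧ V n s ⊆ closure (⋃ t ∈ A, V (n + 1) t) := fun n s hs =>
    exists_pairwiseDisjoint_subset_closure_biUnion (fun t => P (n + 1) t ∧ R n s t)
      (V (n + 1)) (hV n s) (hex n s hs)
  choose! T hTQ hTdisj hTdense using hfam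
  let L : ℕ → Set S := fun n => Nat.rec {s₀} (fun n A => ⋃ s ∈ A, T n s) n
  have hLsucc : ∀ n t, t ∈ L (n + 1) ↔ ∃ s ∈ L n, t ∈ T n s := fun n t => by simp [L]
  have hLP : ∀ n, ∀ s ∈ L n, P n s := by
    intro n
    induction n with
    | zero => exact fun s hs => (mem_singleton_iff.1 hs : s = s₀) ▸ hP
    | succ n ih =>
      intro t ht
      obtain ⟨s, hs, hst⟩ := (hLsucc n t).1 ht
      exact (hTQ n s (ih s hs) t hst).1
  have hLdisj : ∀ n, (L n).PairwiseDisjoint (V n) := by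
    intro n
    induction n with
    | zero => exact pairwiseDisjoint_singleton _ _
    | succ n ih =>
      intro t ht t' ht' hne
      obtain ⟨s, hs, hst⟩ := (hLsucc n t).1 ht
      obtain ⟨s', hs', hst'⟩ := (hLsucc n t').1 ht'
      by_cases hss : s = s'
      · subst hss
        exact hTdisj n s (hLP n s hs) hst hst' hne
      · exact (ih hs hs' hss).mono (hmono n s t (hTQ n s (hLP n s hs) t hst).2)
          (hmono n s' t' (hTQ n s' (hLP n s' hs') t' hst').2)
  let W : ℕ → Set X := fun n => ⋃ s ∈ L n, V n s
  have hWopen : ∀ n, IsOpen (W n) := fun n => isOpen_biUnion fun s _ => hV n s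
  have hWdense : ∀ n, V 0 s₀ ⊆ closure (W n) := by
    intro n
    induction n with
    | zero => exact fun x hx => subset_closure (mem_biUnion (mem_singleton s₀) hx)
    | succ n ih =>
      refine ih.trans (closure_minimal (iUnion₂_subset fun s hs => ?_) isClosed_closure)
      refine (hTdense n s (hLP n s hs)).trans (closure_mono ?_)
      exact iUnion₂_subset fun t ht x hx => mem_biUnion ((hLsucc n t).2 ⟨s, hs, ht⟩) hx
  have hres : ∀ n, W n ∪ (closure (V 0 s₀))ᶜ ∈ residual X := by
    refine fun n => residual_of_dense_open
      ((hWopen n).union isClosed_closure.isOpen_compl) fun x => ?_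
    by_cases hx : x ∈ closure (V 0 s₀)
    · exact closure_mono subset_union_left
        (closure_minimal (hWdense n) isClosed_closure hx)
    · exact subset_closure (Or.inr hx)
  filter_upwards [eventually_countable_forall.2 hres] with x hx hx₀
  have hxW : ∀ n, ∃ s ∈ L n, x ∈ V n s := fun n => by
    simpa [W] using (hx n).resolve_right fun h => h (subset_closure hx₀)
  choose s hsL hsx using hxW
  refine ⟨s, fun n => ⟨hLP n _ (hsL n), hsx n⟩, fun n => ?_⟩
  obtain ⟨r, hr, hrs⟩ := (hLsucc n _).1 (hsL (n + 1))
  have hR := (hTQ n r (hLP n r hr) _ hrs).2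
  have hrn : r = s n := by
    by_contra hne
    exact disjoint_left.1 (hLdisj n hr (hsL n) hne) (hmono n _ _ hR (hsx (n + 1))) (hsx n)
  rwa [hrn] at hR

/-- `G 0, …, G (2 * n)` is an initial segment of a play consistent with the strategy `f` of
player 1. -/
def IsPartialPlay {X : Type*} (𝓖 : Set (Set X)) (f : (k : ℕ) → (Fin (2 * k) → Set X) → Set X)
    (n : ℕ) (G : ℕ → Set X) : Prop :=
  (∀ i ≤ 2 * n, G i ∈ 𝓖) ∧ (∀ i < 2 * n, G (i + 1) ⊆ G i) ∧
    ∀ k ≤ n, G (2 * k) = f k (fun i => G i.val)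

/-- A partial play can be extended by any legal move `B` of player 2. -/
lemma IsPartialPlay.exists_extend {X : Type*} [TopologicalSpace X] {𝓖 : Set (Set X)}
    {target : Set X} {f : (k : ℕ) → (Fin (2 * k) → Set X) → Set X}
    (hf : IsWinningStrategyP1 𝓖 target f) {n : ℕ} {G : ℕ → Set X}
    (hG : IsPartialPlay 𝓖 f n G) {B : Set X} (hB : B ∈ 𝓖) (hBG : B ⊆ G (2 * n)) :
    ∃ G', IsPartialPlay 𝓖 f (n + 1) G' ∧ (∀ i ≤ 2 * n, G' i = G i) ∧ G' (2 * n + 1) = B := by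
  obtain ⟨hG𝓖, hGmono, hGf⟩ := hG
  let H : ℕ → Set X := fun i => if i ≤ 2 * n then G i else B
  let C : Set X := f (n + 1) (fun i => H i.val)
  have hHG : ∀ i ≤ 2 * n, H i = G i := fun i hi => if_pos hi
  have hHB : H (2 * n + 1) = B := if_neg (by lia)
  have hH𝓖 : ∀ i, H i ∈ 𝓖 := fun i => by
    by_cases hi : i ≤ 2 * n
    · rw [hHG i hi]; exact hG𝓖 i hi
    · simpa [H, hi] using hB
  have hHmono : ∀ i ≤ 2 * n, H (i + 1) ⊆ H i := fun i hi => by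
    rcases hi.lt_or_eq with hlt | rfl
    · rw [hHG i hi, hHG (i + 1) hlt]; exact hGmono i hlt
    · rw [hHB, hHG _ le_rfl]; exact hBG
  obtain ⟨hC, hCsub⟩ := hf.1 (n + 1) (fun i => H i.val) (fun i => hH𝓖 i) (by
    intro i j hij
    have hj := j.isLt
    simp only [← hij]
    exact hHmono i (by lia))
  have hCB : C ⊆ B := by
    have := hCsub ⟨2 * n + 1, by lia⟩ (by simp only; lia)
    rwa [hHB] at this
  let G' : ℕ → Set X := fun i => if i ≤ 2 * n + 1 then H i else C
  have hG'H : ∀ i ≤ 2 * n + 1, G' i = H i := fun i hi => if_pos hi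
  have hG'C : G' (2 * n + 2) = C := if_neg (by lia)
  have hG'G : ∀ i ≤ 2 * n, G' i = G i := fun i hi => (hG'H i (by lia)).trans (hHG i hi)
  refine ⟨G', ⟨fun i _ => ?_, fun i hi => ?_, fun k hk => ?_⟩, hG'G, (hG'H _ le_rfl).trans hHB⟩
  · by_cases hi : i ≤ 2 * n + 1
    · rw [hG'H i hi]; exact hH𝓖 i
    · simpa [G', hi] using hC
  · by_cases hi' : i ≤ 2 * n
    · rw [hG'H i (by lia), hG'H (i + 1) (by lia)]; exact hHmono i hi'
    · obtain rfl : i = 2 * n + 1 := by lia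
      rw [hG'C, hG'H _ le_rfl, hHB]; exact hCB
  · rcases hk.lt_or_eq with hlt | rfl
    · rw [hG'G _ (by lia), hGf k (by lia)]
      congr 1
      funext i
      exact (hG'G i (by have := i.isLt; lia)).symm
    · change G' (2 * n + 2) = _
      rw [hG'C]
      simp only [C]
      congr 1
      funext i
      exact (hG'H i (by have := i.isLt; lia)).symm

/-- A coherent sequence of partial plays is won by player 1 if the strategy is winning. -/
lemma IsWinningStrategyP1.exists_mem_of_coherent {X : Type*} [TopologicalSpace X]
    {𝓖 : Set (Set X)} {target : Set X} {f : (k : ℕ) → (Fin (2 * k) → Set X) → Set X}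
    (hf : IsWinningStrategyP1 𝓖 target f) (s : ℕ → ℕ → Set X)
    (hs : ∀ n, IsPartialPlay 𝓖 f n (s n)) (hcoh : ∀ n, ∀ i ≤ 2 * n, s (n + 1) i = s n i) :
    ∃ y ∈ target, ∀ n, ∀ i ≤ 2 * n, y ∈ s n i := by
  have hle : ∀ n m, n ≤ m → ∀ i ≤ 2 * n, s m i = s n i := by
    intro n m hnm
    induction m, hnm using Nat.le_induction with
    | base => exact fun i _ => rfl
    | succ m hnm ih => exact fun i hi => (hcoh m i (by lia)).trans (ih i hi)
  let G : ℕ → Set X := fun i => s i i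
  have hG : ∀ n, ∀ i ≤ 2 * n, G i = s n i := fun n i hi =>
    (hle i (max n i) (le_max_right _ _) i (by lia)).symm.trans
      (hle n (max n i) (le_max_left _ _) i hi)
  obtain ⟨y, hy, hyG⟩ := hf.2 G (fun n => (hs n).1 n (by lia))
    (fun n => by
      rw [hG (n + 1) n (by lia)]
      exact (hs (n + 1)).2.1 n (by lia))
    (fun k => by
      rw [hG k (2 * k) le_rfl, (hs k).2.2 k le_rfl]
      congr 1
      funext i
      exact (hG k i i.isLt.le).symm)
  exact ⟨y, hy, fun n i hi => hG n i hi ▸ mem_iInter.1 hyG i⟩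

/-- A winning strategy of player 1 makes the complement of the target meager in the interior of
the first move. -/
lemma IsWinningStrategyP1.isMeagre_inter {X : Type*} [MetricSpace X] {M : Set X}
    {𝓖 : Set (Set X)} (h𝓖₁ : ∀ G ∈ 𝓖, (interior G).Nonempty)
    (h𝓖₂ : ∀ U : Set X, IsOpen U → U.Nonempty → ∃ G ∈ 𝓖, G ⊆ U)
    {f : (k : ℕ) → (Fin (2 * k) → Set X) → Set X} (hf : IsWinningStrategyP1 𝓖 Mᶜ f) :
    IsMeagre (interior (f 0 fun _ => ∅) ∩ M) := by
  have hempty : ∀ h : Fin (2 * 0) → Set X, h = fun _ => ∅ := fun h => funext fun i => i.elim0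
  have hroot : IsPartialPlay 𝓖 f 0 (fun _ => f 0 fun _ => ∅) := by
    refine ⟨fun _ _ => (hf.1 0 _ (fun i => i.elim0) fun i => i.elim0).1,
      fun i hi => absurd hi (by lia), fun k hk => ?_⟩
    obtain rfl : k = 0 := by lia
    exact congrArg (f 0) (hempty _).symm
  have key := eventually_residual_exists_branch (IsPartialPlay 𝓖 f)
    (fun n G G' => (∀ i ≤ 2 * n, G' i = G i) ∧ G' (2 * n + 2) ⊆ G' (2 * n + 1) ∧
      G' (2 * n + 1) ⊆ G (2 * n) ∧
      ∀ x ∈ G' (2 * n + 1), ∀ y ∈ G' (2 * n + 1), dist x y < 1 / ((n : ℝ) + 1))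
    (fun n G => interior (G (2 * n))) (fun _ => f 0 fun _ => ∅) hroot
    (fun _ _ => isOpen_interior)
    (fun n G G' h => interior_mono (h.2.1.trans h.2.2.1)) (by
      rintro n G hG O hOG hO ⟨z, hz⟩
      have hε : (0 : ℝ) < 1 / ((n : ℝ) + 1) := by positivity
      obtain ⟨B, hB, hBO⟩ := h𝓖₂ (O ∩ Metric.ball z (1 / ((n : ℝ) + 1) / 2))
        (hO.inter Metric.isOpen_ball) ⟨z, hz, Metric.mem_ball_self (half_pos hε)⟩
      have hBO' : B ⊆ O := hBO.trans inter_subset_left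
      have hBG : B ⊆ G (2 * n) := hBO'.trans (hOG.trans interior_subset)
      obtain ⟨G', hG', hagree, hGB⟩ := hG.exists_extend hf hB hBG
      have hsub : G' (2 * n + 2) ⊆ G' (2 * n + 1) := hG'.2.1 (2 * n + 1) (by lia)
      refine ⟨G', ⟨hG', hagree, hsub, hGB ▸ hBG, fun x hx y hy => ?_⟩,
        h𝓖₁ _ (hG'.1 _ le_rfl), interior_subset.trans (hsub.trans (hGB ▸ hBO'))⟩
      rw [hGB] at hx hy
      have hx' := Metric.mem_ball.1 (hBO hx).2
      have hy' := Metric.mem_ball.1 (hBO hy).2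
      linarith [dist_triangle_right x y z])
  rw [IsMeagre]
  filter_upwards [key] with x hx
  rintro ⟨hxU, hxM⟩
  obtain ⟨s, hs, hR⟩ := hx hxU
  obtain ⟨y, hy, hys⟩ := hf.exists_mem_of_coherent s (fun n => (hs n).1) fun n => (hR n).1
  have hdist : ∀ n : ℕ, dist x y < 1 / ((n : ℝ) + 1) := fun n =>
    (hR n).2.2.2 x ((hR n).2.1 (interior_subset (hs (n + 1)).2)) y (hys (n + 1) _ (by lia))
  have hxy : x = y := by
    by_contra hne
    obtain ⟨n, hn⟩ := exists_nat_one_div_lt (dist_pos.2 hne)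
    exact lt_asymm hn (hdist n)
  exact hy (hxy ▸ hxM)

/-- In a complete metric space player 1 wins by first moving into an open set in which `M` is
meager, and then successively avoiding the nowhere dense sets covering `M` there. -/
lemma exists_isWinningStrategyP1_of_isMeagre_inter {X : Type*} [MetricSpace X] [CompleteSpace X]
    {M : Set X} {𝓖 : Set (Set X)} (h𝓖₁ : ∀ G ∈ 𝓖, (interior G).Nonempty)
    (h𝓖₂ : ∀ U : Set X, IsOpen U → U.Nonempty → ∃ G ∈ 𝓖, G ⊆ U)
    {U : Set X} (hU : IsOpen U) (hUne : U.Nonempty) (hUM : IsMeagre (U ∩ M)) :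
    ∃ f, IsWinningStrategyP1 𝓖 Mᶜ f := by
  obtain ⟨D, hDopen, hDdense, hDM⟩ : ∃ D : ℕ → Set X, (∀ n, IsOpen (D n)) ∧
      (∀ n, Dense (D n)) ∧ ⋂ n, D n ⊆ (U ∩ M)ᶜ := by
    obtain ⟨S, hSo, hSd, hSc, hS⟩ := mem_residual_iff.1 hUM
    obtain ⟨D, hD⟩ := (hSc.insert univ).exists_eq_range (insert_nonempty _ _)
    have hmem : ∀ n, D n ∈ insert univ S := fun n => hD ▸ mem_range_self n
    refine ⟨D, fun n => ?_, fun n => ?_, ?_⟩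
    · rcases hmem n with h | h
      · exact h ▸ isOpen_univ
      · exact hSo _ h
    · rcases hmem n with h | h
      · exact h ▸ dense_univ
      · exact hSd _ h
    · rw [← sInter_range, ← hD]
      exact (sInter_subset_sInter (subset_insert _ _)).trans hS
  have hstep : ∀ (n : ℕ) (V : Set X), (interior V).Nonempty →
      ∃ G ∈ 𝓖, closure G ⊆ V ∩ D n ∧ ∃ z, G ⊆ Metric.closedBall z (1 / ((n : ℝ) + 1)) := by
    intro n V hV
    obtain ⟨z, hzV, hzD⟩ := (hDdense n).inter_open_nonempty _ isOpen_interior hV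
    obtain ⟨r, hr, hrV⟩ := Metric.nhds_basis_closedBall.mem_iff.1
      ((isOpen_interior.inter (hDopen n)).mem_nhds ⟨hzV, hzD⟩)
    have hε : (0 : ℝ) < 1 / ((n : ℝ) + 1) := by positivity
    obtain ⟨G, hG, hGsub⟩ := h𝓖₂ (Metric.ball z (min r (1 / ((n : ℝ) + 1))))
      Metric.isOpen_ball ⟨z, Metric.mem_ball_self (lt_min hr hε)⟩
    refine ⟨G, hG, ?_, z, hGsub.trans (Metric.ball_subset_closedBall.trans
      (Metric.closedBall_subset_closedBall (min_le_right _ _)))⟩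
    have hcl : closure G ⊆ Metric.closedBall z r :=
      closure_minimal (hGsub.trans (Metric.ball_subset_closedBall.trans
        (Metric.closedBall_subset_closedBall (min_le_left _ _)))) Metric.isClosed_closedBall
    exact (hcl.trans hrV).trans (inter_subset_inter_left _ interior_subset)
  choose! g hg𝓖 hgcl c hgc using hstep
  let prev : (k : ℕ) → (Fin (2 * k) → Set X) → Set X := fun k h =>
    if hk : 0 < k then h ⟨2 * k - 1, by lia⟩ else U
  have hprev : ∀ (k : ℕ) (h : Fin (2 * k) → Set X), (∀ i, h i ∈ 𝓖) →
      (interior (prev k h)).Nonempty := by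
    intro k h hh
    by_cases hk : 0 < k
    · simpa only [prev, dif_pos hk] using h𝓖₁ _ (hh _)
    · simpa only [prev, dif_neg hk, hU.interior_eq] using hUne
  refine ⟨fun k h => g k (prev k h), fun k h hh _ => ⟨hg𝓖 k _ (hprev k h hh), ?_⟩, ?_⟩
  · intro i hi
    have hk : 0 < k := by lia
    have hpi : prev k h = h i := by
      simp only [prev, dif_pos hk]
      congr 1
      ext
      simp only
      lia
    exact hpi ▸ subset_closure.trans ((hgcl k _ (hprev k h hh)).trans inter_subset_left)
  · intro G hG𝓖 hGmono hGf
    have hanti : Antitone G := antitone_nat_of_succ_le hGmono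
    have hne : ∀ k, (interior (prev k fun i => G i.val)).Nonempty := fun k =>
      hprev k _ fun i => hG𝓖 i
    have hcl : ∀ k, closure (G (2 * k)) ⊆ prev k (fun i => G i.val) ∩ D k := fun k => by
      rw [hGf k]; exact hgcl k _ (hne k)
    have hball : ∀ k, ∃ z, G (2 * k) ⊆ Metric.closedBall z (1 / ((k : ℝ) + 1)) := fun k => by
      rw [hGf k]; exact ⟨_, hgc k _ (hne k)⟩
    choose z hz using hball
    have hclball : ∀ k, closure (G (2 * k)) ⊆ Metric.closedBall (z k) (1 / ((k : ℝ) + 1)) :=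
      fun k => closure_minimal (hz k) Metric.isClosed_closedBall
    have hbdd : ∀ k, Bornology.IsBounded (closure (G (2 * k))) := fun k =>
      Metric.isBounded_closedBall.subset (hclball k)
    have hdiam : Tendsto (fun k => Metric.diam (closure (G (2 * k)))) atTop (𝓝 0) := by
      refine squeeze_zero (g := fun k : ℕ => 2 * (1 / ((k : ℝ) + 1)))
        (fun k => Metric.diam_nonneg) (fun k => ?_)
        (by simpa using (tendsto_one_div_add_atTop_nhds_zero_nat (𝕜 := ℝ)).const_mul 2)
      exact (Metric.diam_mono (hclball k) Metric.isBounded_closedBall).trans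
        (Metric.diam_closedBall (by positivity))
    obtain ⟨x, hx⟩ := Metric.nonempty_iInter_of_nonempty_biInter
      (fun k => isClosed_closure (s := G (2 * k))) hbdd
      (fun N => by
        obtain ⟨y, hy⟩ := h𝓖₁ _ (hG𝓖 (2 * N))
        exact ⟨y, mem_iInter₂.2 fun k hk =>
          subset_closure (hanti (by lia) (interior_subset hy))⟩) hdiam
    have hxk : ∀ k, x ∈ prev k (fun i => G i.val) ∩ D k := fun k => hcl k (mem_iInter.1 hx k)
    have hxU : x ∈ U := by simpa [prev] using (hxk 0).1
    have hxG : ∀ n, x ∈ G n := fun n => by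
      have h := (hxk (n + 1)).1
      simp only [prev, dif_pos n.succ_pos] at h
      exact hanti (by lia) h
    exact ⟨x, fun hxM => hDM (mem_iInter.2 fun k => (hxk k).2) ⟨hxU, hxM⟩, mem_iInter.2 hxG⟩

/-- In a nonempty complete metric space, if every member of `𝓖` has nonempty interior and
every nonempty open set contains a member of `𝓖`, then player 1 has a winning strategy in the
Banach–Mazur game `BM⟨X∖M, M⟩` if and only if `M` is of first category at some point of `X`,
i.e. there is a nonempty open set `U` with `U ∩ M` meager in `X`. -/
theorem banach_mazur_winning_strategy_P1_iff_meagre_at_some_point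
    {X : Type*} [MetricSpace X] [CompleteSpace X] [Nonempty X]
    (M : Set X) (𝓖 : Set (Set X))
    (h𝓖₁ : ∀ G ∈ 𝓖, (interior G).Nonempty)
    (h𝓖₂ : ∀ U : Set X, IsOpen U → U.Nonempty → ∃ G ∈ 𝓖, G ⊆ U) :
    (∃ f, IsWinningStrategyP1 𝓖 Mᶜ f) ↔
      ∃ U : Set X, IsOpen U ∧ U.Nonempty ∧ IsMeagre (U ∩ M) := by
  constructor
  · rintro ⟨f, hf⟩
    exact ⟨interior (f 0 fun _ => ∅), isOpen_interior,
      h𝓖₁ _ (hf.1 0 _ (fun i => i.elim0) fun i => i.elim0).1, hf.isMeagre_inter h𝓖₁ h𝓖₂⟩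
  · rintro ⟨U, hU, hUne, hUM⟩
    exact exists_isWinningStrategyP1_of_isMeagre_inter h𝓖₁ h𝓖₂ hU hUne hUM
end

section
/- Let X be a topological space and T : X → X a homeomorphism admitting no nonempty open wandering set. Then for every open set E ⊆ X and every natural number n, the set Fₙ(E) = {x ∈ E : T⁻ʲ(x) ∉ E for all j > n} is nowhere dense in X. -/
/-- An open set `E` is wandering for `T : X → X` if the preimages `T⁻ⁱ(E)`, `i = 0, 1, 2, …`,
are pairwise disjoint. -/
def IsWanderingSet {X : Type*} (T : X → X) (E : Set X) : Prop :=
  ∀ i j : ℕ, i ≠ j → Disjoint (T^[i] ⁻¹' E) (T^[j] ⁻¹' E)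

/-- `T` admits no nonempty open wandering set. -/
def HasNoNonemptyOpenWanderingSet {X : Type*} [TopologicalSpace X] (T : X → X) : Prop :=
  ∀ E : Set X, IsOpen E → E.Nonempty → ¬ IsWanderingSet T E

/-- A set which is not wandering contains a point returning to it at a positive time. -/
theorem exists_pos_iterate_mem_of_not_isWanderingSet {X : Type*} {T : X → X} {V : Set X}
    (hV : ¬ IsWanderingSet T V) : ∃ m, 0 < m ∧ ∃ x ∈ V, T^[m] x ∈ V := by
  contrapose! hV
  have disjoint_of_lt : ∀ i j : ℕ, i < j → Disjoint (T^[i] ⁻¹' V) (T^[j] ⁻¹' V) := by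
    refine fun i j hij => Set.disjoint_left.2 fun x hi hj => ?_
    refine hV (j - i) (Nat.sub_pos_of_lt hij) _ hi ?_
    rwa [← Function.iterate_add_apply, Nat.sub_add_cancel hij.le]
  intro i j hij
  rcases hij.lt_or_gt with h | h
  · exact disjoint_of_lt i j h
  · exact (disjoint_of_lt j i h).symm

/-- If a continuous map has no nonempty open wandering set, then every nonempty open set contains
points returning to it at arbitrarily large times. -/
theorem HasNoNonemptyOpenWanderingSet.exists_lt_iterate_mem {X : Type*} [TopologicalSpace X]
    {T : X → X} (hw : HasNoNonemptyOpenWanderingSet T) (hT : Continuous T) (n : ℕ)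
    {V : Set X} (hVo : IsOpen V) (hV : V.Nonempty) :
    ∃ m, n < m ∧ ∃ x ∈ V, T^[m] x ∈ V := by
  induction n generalizing V with
  | zero => exact exists_pos_iterate_mem_of_not_isWanderingSet (hw V hVo hV)
  | succ n ih =>
    obtain ⟨k, hk, y, hy, hky⟩ := exists_pos_iterate_mem_of_not_isWanderingSet (hw V hVo hV)
    obtain ⟨m, hm, x, hx, hmx⟩ :=
      ih (hVo.inter (hVo.preimage (hT.iterate k))) ⟨y, hy, hky⟩
    refine ⟨k + m, by omega, x, hx.1, ?_⟩
    rw [Function.iterate_add_apply]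
    exact hmx.2

/-- If `T` is a homeomorphism of `X` with no nonempty open wandering set, then for every
open set `E` and every `n : ℕ`, the set `Fₙ(E) = {x ∈ E : T⁻ʲ(x) ∉ E for all j > n}`
is nowhere dense in `X`. -/
theorem isNowhereDense_of_no_open_wandering_set
    {X : Type*} [TopologicalSpace X] (T : X ≃ₜ X)
    (hw : HasNoNonemptyOpenWanderingSet (⇑T))
    (E : Set X) (hE : IsOpen E) (n : ℕ) :
    IsNowhereDense {x ∈ E | ∀ j : ℕ, n < j → (⇑T.symm)^[j] x ∉ E} := by
  rw [IsNowhereDense, Set.eq_empty_iff_forall_notMem]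
  intro x hx
  set F : Set X := {x ∈ E | ∀ j : ℕ, n < j → (⇑T.symm)^[j] x ∉ E}
  have closure_subset : closure F ⊆ {x | ∀ j : ℕ, n < j → (⇑T.symm)^[j] x ∉ E} := by
    refine closure_minimal (fun x hx => hx.2) ?_
    simp only [Set.ofPred_forall]
    exact isClosed_iInter fun j => isClosed_iInter fun _ =>
      hE.isClosed_compl.preimage (T.symm.continuous.iterate j)
  obtain ⟨y, hyU, hyF⟩ := mem_closure_iff.1 (interior_subset hx) _ isOpen_interior hx
  obtain ⟨m, hm, z, hz, hmz⟩ := hw.exists_lt_iterate_mem T.continuous n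
    (isOpen_interior.inter hE) ⟨y, hyU, hyF.1⟩
  refine closure_subset (interior_subset hmz.1) m hm ?_
  rw [Function.LeftInverse.iterate T.symm_apply_apply m z]
  exact hz.2
end

section
/- Let X be a topological space and T : X → X a homeomorphism admitting no nonempty open wandering set. Then for every open set E ⊆ X, the set N(E) = {x ∈ E : the set {j ∈ ℕ : T⁻ʲ(x) ∈ E} is finite} is meager (of first category) in X. -/
/-- Without nonempty open wandering sets, every nonempty open set meets one of its own
preimages under a positive iterate. -/
lemma HasNoNonemptyOpenWanderingSet.exists_pos_return {X : Type*} [TopologicalSpace X]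
    {T : X → X} (hw : HasNoNonemptyOpenWanderingSet T) {V : Set X} (hV : IsOpen V)
    (hne : V.Nonempty) : ∃ k, 0 < k ∧ (V ∩ T^[k] ⁻¹' V).Nonempty := by
  have return_of_lt : ∀ {a b : ℕ} {x : X}, a < b → T^[a] x ∈ V → T^[b] x ∈ V →
      ∃ k, 0 < k ∧ (V ∩ T^[k] ⁻¹' V).Nonempty := by
    intro a b x hab ha hb
    refine ⟨b - a, Nat.sub_pos_of_lt hab, T^[a] x, ha, ?_⟩
    rwa [Set.mem_preimage, ← Function.iterate_add_apply, Nat.sub_add_cancel hab.le]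
  have h := hw V hV hne
  simp only [IsWanderingSet, not_forall, Set.not_disjoint_iff] at h
  obtain ⟨i, j, hij, x, hi, hj⟩ := h
  rcases lt_or_gt_of_ne hij with h | h
  · exact return_of_lt h hi hj
  · exact return_of_lt h hj hi

/-- Without nonempty open wandering sets, every nonempty open set returns to itself at
arbitrarily large times. -/
lemma HasNoNonemptyOpenWanderingSet.exists_ge_return {X : Type*} [TopologicalSpace X]
    {T : X → X} (hw : HasNoNonemptyOpenWanderingSet T) (hT : Continuous T) (n : ℕ)
    {V : Set X} (hV : IsOpen V) (hne : V.Nonempty) :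
    ∃ k, n ≤ k ∧ (V ∩ T^[k] ⁻¹' V).Nonempty := by
  induction n generalizing V with
  | zero => exact ⟨0, le_rfl, by simpa using hne⟩
  | succ n ih =>
    obtain ⟨k, hk, hkne⟩ := hw.exists_pos_return hV hne
    obtain ⟨m, hm, x, hx, hmx⟩ := ih (hV.inter (hV.preimage (hT.iterate k))) hkne
    refine ⟨k + m, by omega, x, hx.1, ?_⟩
    rw [Set.mem_preimage, Function.iterate_add_apply]
    exact hmx.2

/-- The points of an open set `E` that never return to `E` under backward iteration from
time `n` on form a nowhere dense set. -/
lemma HasNoNonemptyOpenWanderingSet.isNowhereDense_no_return_after {X : Type*}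
    [TopologicalSpace X] {T : X ≃ₜ X} (hw : HasNoNonemptyOpenWanderingSet (⇑T))
    {E : Set X} (hE : IsOpen E) (n : ℕ) :
    IsNowhereDense {x ∈ E | ∀ j, n ≤ j → (⇑T.symm)^[j] x ∉ E} := by
  set A : Set X := {x | ∀ j, n ≤ j → (⇑T.symm)^[j] x ∉ E} with hA
  change interior (closure (E ∩ A)) = ∅
  have hAc : IsClosed A := by
    simp only [hA, Set.ofPred_forall]
    exact isClosed_iInter fun j ↦ isClosed_iInter fun _ ↦
      (hE.preimage (T.symm.continuous.iterate j)).isClosed_compl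
  by_contra hne
  obtain ⟨x, hx⟩ := Set.nonempty_iff_ne_empty.mpr hne
  obtain ⟨y, hyU, hyE, -⟩ :=
    mem_closure_iff.mp (interior_subset hx) _ isOpen_interior hx
  obtain ⟨k, hk, z, hz, hkz⟩ :=
    hw.exists_ge_return T.continuous n (isOpen_interior.inter hE) ⟨y, hyU, hyE⟩
  have hkA : T^[k] z ∈ A :=
    closure_minimal Set.inter_subset_right hAc (interior_subset hkz.1)
  refine hkA k hk ?_
  rw [Function.LeftInverse.iterate T.symm_apply_apply k z]
  exact hz.2

/-- If `T` is a homeomorphism of `X` with no nonempty open wandering set, then for every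
open set `E`, the set `N(E)` of points of `E` that return to `E` under backward iteration
of `T` only finitely often is meager in `X`. -/
theorem isMeagre_finitely_returning_of_no_open_wandering_set
    {X : Type*} [TopologicalSpace X] (T : X ≃ₜ X)
    (hw : HasNoNonemptyOpenWanderingSet (⇑T))
    (E : Set X) (hE : IsOpen E) :
    IsMeagre {x ∈ E | {j : ℕ | (⇑T.symm)^[j] x ∈ E}.Finite} := by
  refine (isMeagre_iUnion fun n ↦ (hw.isNowhereDense_no_return_after hE n).isMeagre).mono ?_
  rintro x ⟨hxE, hfin⟩
  obtain ⟨b, hb⟩ := hfin.bddAbove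
  exact Set.mem_iUnion.mpr
    ⟨b + 1, hxE, fun j hj hjE ↦ Nat.not_succ_le_self b (hj.trans (hb hjE))⟩
end

section
/- Let X ⊆ ℝⁿ be a nonempty bounded open set and let T : X → X be a homeomorphism of X onto itself that preserves Lebesgue measure (i.e., the Lebesgue measure of T⁻¹(A) equals that of A for every Borel set A ⊆ X). Then the set of points of X that are not recurrent under T has Lebesgue measure zero and is meager (of first category) in X. -/
open MeasureTheory

/- Equip a subset of `ℝⁿ` with the (restricted) Lebesgue measure. -/
attribute [local instance] MeasureTheory.Measure.Subtype.measureSpace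

/-- A point `x` is recurrent under `T` if for every open set `U` containing `x`,
`Tⁱ(x) ∈ U` for infinitely many `i ≥ 0`. -/
def IsRecurrentPoint {X : Type*} [TopologicalSpace X] (T : X → X) (x : X) : Prop :=
  ∀ U : Set X, IsOpen U → x ∈ U → {i : ℕ | T^[i] x ∈ U}.Infinite

/-- In a second countable perfectly normal space, the recurrent points of a continuous map form
a Gδ set. -/
theorem isGδ_setOf_isRecurrentPoint {X : Type*} [TopologicalSpace X]
    [SecondCountableTopology X] [PerfectlyNormalSpace X] {T : X → X} (hT : Continuous T) :
    IsGδ {x : X | IsRecurrentPoint T x} := by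
  have h : {x : X | IsRecurrentPoint T x} =
      ⋂ U ∈ TopologicalSpace.countableBasis X, ⋂ N : ℕ,
        (Uᶜ ∪ ⋃ i : ℕ, ⋃ _ : N < i, T^[i] ⁻¹' U) := by
    ext x
    simp only [Set.mem_ofPred_eq, Set.mem_iInter, Set.mem_union, Set.mem_compl_iff,
      Set.mem_iUnion, Set.mem_preimage, exists_prop, ← imp_iff_not_or]
    constructor
    · intro hx U hU N hxU
      obtain ⟨i, hi, hNi⟩ :=
        (hx U (TopologicalSpace.isOpen_of_mem_countableBasis hU) hxU).exists_gt N
      exact ⟨i, hNi, hi⟩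
    · intro hx U hU hxU
      obtain ⟨V, hV, hxV, hVU⟩ :=
        (TopologicalSpace.isBasis_countableBasis X).exists_subset_of_mem_open hxU hU
      refine Set.infinite_of_forall_exists_gt fun N => ?_
      obtain ⟨i, hNi, hi⟩ := hx V hV N hxV
      exact ⟨i, hVU hi, hNi⟩
  rw [h]
  refine .biInter (TopologicalSpace.countable_countableBasis X) fun U hU => .iInter fun N => ?_
  have hUo := TopologicalSpace.isOpen_of_mem_countableBasis hU
  exact hUo.isClosed_compl.isGδ.union
    (isOpen_iUnion fun i => isOpen_iUnion fun _ => hUo.preimage (hT.iterate i)).isGδ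

/-- Almost every point is recurrent under a conservative map. -/
theorem MeasureTheory.Conservative.ae_isRecurrentPoint {X : Type*} [TopologicalSpace X]
    [SecondCountableTopology X] [MeasurableSpace X] [OpensMeasurableSpace X] {T : X → X}
    {μ : Measure X} (hT : Conservative T μ) : ∀ᵐ x ∂μ, IsRecurrentPoint T x := by
  filter_upwards [hT.ae_frequently_mem_of_mem_nhds] with x hx U hU hxU
  exact Nat.frequently_atTop_iff_infinite.1 (hx U (hU.mem_nhds hxU))

/-- Poincaré recurrence theorem (measure and category version): if `X ⊆ ℝⁿ` is a nonempty
bounded open set and `T` is a homeomorphism of `X` onto itself preserving Lebesgue measure,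
then the set of non-recurrent points of `X` has Lebesgue measure zero and is meager in `X`. -/
theorem poincare_recurrence_measure_and_category
    {n : ℕ} (X : Set (Fin n → ℝ)) (hXne : X.Nonempty) (hXopen : IsOpen X)
    (hXbdd : Bornology.IsBounded X)
    (T : X ≃ₜ X)
    (hpres : ∀ A : Set X, MeasurableSet A → volume (⇑T ⁻¹' A) = volume A) :
    volume {x : X | ¬ IsRecurrentPoint (⇑T) x} = 0 ∧
      IsMeagre {x : X | ¬ IsRecurrentPoint (⇑T) x} := by
  have hpos : (volume : Measure X).IsOpenPosMeasure :=
    .comap volume hXopen.isOpenEmbedding_subtypeVal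
  have hfin : IsFiniteMeasure (volume : Measure X) := by
    refine ⟨?_⟩
    rw [Measure.Subtype.volume_univ hXopen.measurableSet.nullMeasurableSet]
    exact hXbdd.measure_lt_top
  have hT : MeasurePreserving T volume volume := by
    refine ⟨T.continuous.measurable, Measure.ext fun A hA => ?_⟩
    rw [Measure.map_apply T.continuous.measurable hA, hpres A hA]
  have hae := hT.conservative.ae_isRecurrentPoint
  refine ⟨ae_iff.1 hae, ?_⟩
  rw [IsMeagre, ← Set.compl_ofPred, compl_compl]
  exact residual_of_dense_Gδ (isGδ_setOf_isRecurrentPoint T.continuous)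
    (Measure.dense_of_ae hae)
end
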